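/- Let 0 < α < 2 and 0 < p < α+1. There exists a constant c > 0 such that for every (z₁,z₂) ∈ ℝ² with z₂ ≥ 0 and 0 < z₁² + z₂² < 1, the principal value limit Δ(z₁,z₂) := lim_{ε↓0} 𝒜(1,−α)·∫_{{y ∈ ℝ : |y−z₁| > ε}} ((y² + z₂²)^{(p−1)/2} − (z₁² + z₂²)^{(p−1)/2}) / |y−z₁|^{1+α} dy exists, and moreover |Δ(z₁,z₂)| ≤ c·|z₁|^{p−1−α} whenever z₁ ≠ 0, and |Δ(z₁,z₂)| ≤ c·z₂^{p−1−α} whenever z₂ > 0. -/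

import Mathlib

open MeasureTheory Set Filter

/-- The normalizing constant `𝒜(1,-α) = α·2^{α-1}·π^{-1/2}·Γ((1+α)/2)/Γ(1-α/2)`. -/
noncomputable def Aconst (α : ℝ) : ℝ :=
  α * 2 ^ (α - 1) * Real.pi ^ (-(1 : ℝ) / 2) *
    Real.Gamma ((1 + α) / 2) / Real.Gamma (1 - α / 2)

lemma integrable_comp_abs' {k : ℝ → ℝ} (hk : IntegrableOn k (Ioi 0)) :
    Integrable (fun x : ℝ => k |x|) := by
  have h1 : Integrable (indicator (Ioi (0:ℝ)) k) := (integrable_indicator_iff measurableSet_Ioi).2 hk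
  have h2 := h1.comp_neg
  refine (h1.add h2).congr ?_
  have h0 : ∀ᵐ x : ℝ, x ≠ 0 := by simp [ae_iff]
  filter_upwards [h0] with x hx
  rcases lt_or_gt_of_ne hx with h | h
  · have : ¬ (0 < x) := by linarith
    simp [indicator, this, h, abs_of_neg h]
  · have : ¬ (x < 0) := by linarith
    simp [indicator, this, h, abs_of_pos h]

lemma integrable_near (s c : ℝ) (hs : -1 < s) (hc : 0 ≤ c) :
    Integrable (fun x : ℝ => indicator (Iic c) (fun t => t ^ s) |x|) := by
  apply integrable_comp_abs'
  rw [integrableOn_indicator_iff measurableSet_Iic, inter_comm, Ioi_inter_Iic]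
  rw [← intervalIntegrable_iff_integrableOn_Ioc_of_le hc]
  exact intervalIntegral.intervalIntegrable_rpow' hs

lemma integrable_far (s c : ℝ) (hs : s < -1) (hc : 0 < c) :
    Integrable (fun x : ℝ => indicator (Ioi c) (fun t => t ^ s) |x|) := by
  apply integrable_comp_abs'
  rw [integrableOn_indicator_iff measurableSet_Ioi]
  exact (integrableOn_Ioi_rpow_of_lt hs hc).mono_set inter_subset_left

lemma taylor_rpow (q : ℝ) : ∃ C : ℝ, 0 ≤ C ∧ ∀ t : ℝ, -(3/4) ≤ t → t ≤ 5/4 →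
    |(1 + t) ^ q - 1 - q * t| ≤ C * t ^ 2 := by
  have hcont : ContinuousOn (fun x : ℝ => (q - 1) * (1 + x) ^ (q - 1 - 1)) (Icc (-(3/4)) (5/4)) := by
    apply ContinuousOn.mul continuousOn_const
    apply ContinuousOn.rpow_const (by fun_prop)
    intro x hx; left; have := hx.1; intro h; linarith
  obtain ⟨M, hM⟩ := isCompact_Icc.exists_bound_of_continuousOn hcont
  have hM0 : 0 ≤ M := (norm_nonneg _).trans (hM 0 (by constructor <;> norm_num))
  have hd : ∀ r : ℝ, ∀ x ∈ Icc (-(3/4):ℝ) (5/4),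
      HasDerivAt (fun x : ℝ => (1 + x) ^ r) (r * (1 + x) ^ (r - 1)) x := by
    intro r x hx
    have h1 : HasDerivAt (fun x : ℝ => 1 + x) 1 x := (hasDerivAt_id x).const_add 1
    have := h1.rpow_const (p := r) (Or.inl (by have := hx.1; intro h; linarith))
    simpa using this
  have h1 : ∀ x ∈ Icc (-(3/4):ℝ) (5/4), |(1 + x) ^ (q - 1) - 1| ≤ M * |x| := by
    intro x hx
    have := (convex_Icc (-(3/4):ℝ) (5/4)).norm_image_sub_le_of_norm_hasDerivWithin_le
      (f := fun x : ℝ => (1 + x) ^ (q - 1)) (f' := fun x : ℝ => (q - 1) * (1 + x) ^ (q - 1 - 1)) (C := M)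
      (fun y hy => (hd _ y hy).hasDerivWithinAt) hM (x := 0) (y := x) (by constructor <;> norm_num) hx
    simpa using this
  refine ⟨|q| * M, by positivity, ?_⟩
  intro t ht1 ht2
  have hsub : uIcc 0 t ⊆ Icc (-(3/4):ℝ) (5/4) :=
    uIcc_subset_Icc (by constructor <;> norm_num) ⟨ht1, ht2⟩
  have := (convex_uIcc (0:ℝ) t).norm_image_sub_le_of_norm_hasDerivWithin_le
      (f := fun x : ℝ => (1 + x) ^ q - 1 - q * x) (f' := fun x : ℝ => q * (1 + x) ^ (q - 1) - q * 1)
      (C := |q| * (M * |t|))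
      (fun y hy => (((hd q y (hsub hy)).sub_const 1).sub
        ((hasDerivAt_id y).const_mul q)).hasDerivWithinAt)
      (by
        intro x hx
        rw [← mul_sub, norm_mul, Real.norm_eq_abs, Real.norm_eq_abs]
        have h2 : |x| ≤ |t| := by
          have := abs_sub_left_of_mem_uIcc hx
          simpa using this
        have := h1 x (hsub hx)
        gcongr
        exact this.trans (by gcongr)) (x := 0) (y := t) left_mem_uIcc right_mem_uIcc
  simp only [Real.norm_eq_abs] at this
  simp at this
  calc _ ≤ _ := this
    _ = |q| * M * |t| ^ 2 := by ring
    _ = _ := by rw [sq_abs]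

/-- the compensated integrand -/
noncomputable def gfun (α q a b y : ℝ) : ℝ :=
  ((y ^ 2 + b ^ 2) ^ q - 1 - indicator (Iic (1/2:ℝ)) (fun _ => 2 * q * a * (y - a)) |y - a|)
    / |y - a| ^ (1 + α)

/-- the odd compensator -/
noncomputable def ofun (α q a h : ℝ) : ℝ :=
  indicator (Iic (1/2:ℝ)) (fun _ => 2 * q * a * h) |h| / |h| ^ (1 + α)

noncomputable def bfun (α q C a y : ℝ) : ℝ :=
  C * indicator (Iic (1/2:ℝ)) (fun t => t ^ (1 - α)) |y - a|
  + 2 * 4 ^ (max 0 (2 * q)) *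
      indicator (Ioi (1/2:ℝ)) (fun t => t ^ (max 0 (2 * q) - (1 + α))) |y - a|
  + 2 ^ (1 + α) * indicator (Iic (1:ℝ)) (fun t => t ^ (2 * q)) |y|

lemma bfun_integral (α q C : ℝ) (hα0 : 0 < α) (hα2 : α < 2) (hq0 : -(1/2) < q) (hq1 : 2 * q < α) :
    ∃ K : ℝ, ∀ a, Integrable (bfun α q C a) ∧ ∫ y, bfun α q C a y = K := by
  have hs : max 0 (2 * q) < α := max_lt hα0 hq1
  have i1 := (integrable_near (1 - α) (1/2) (by linarith) (by norm_num)).const_mul C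
  have i2 := (integrable_far (max 0 (2 * q) - (1 + α)) (1/2) (by linarith) (by norm_num)).const_mul
    (2 * 4 ^ (max 0 (2 * q)))
  have i3 := (integrable_near (2 * q) 1 (by linarith) (by norm_num)).const_mul (2 ^ (1 + α))
  have i12 := i1.add i2
  refine ⟨(∫ y, ((fun y : ℝ => C * indicator (Iic (1/2:ℝ)) (fun t => t ^ (1 - α)) |y|) +
    fun y : ℝ => 2 * 4 ^ (max 0 (2 * q)) *
      indicator (Ioi (1/2:ℝ)) (fun t => t ^ (max 0 (2 * q) - (1 + α))) |y|) y) +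
    ∫ y : ℝ, 2 ^ (1 + α) * indicator (Iic (1:ℝ)) (fun t => t ^ (2 * q)) |y|, fun a => ?_⟩
  have j := i12.comp_sub_right a
  refine ⟨j.add i3, ?_⟩
  have h1 := integral_add j i3
  rw [integral_sub_right_eq_self _ a] at h1
  exact h1

lemma gfun_bound (α q : ℝ) (hα0 : 0 < α) :
    ∃ C : ℝ, ∀ a b : ℝ, a ^ 2 + b ^ 2 = 1 → ∀ y : ℝ, y ≠ 0 →
      |gfun α q a b y| ≤ bfun α q C a y := by
  obtain ⟨C0, hC0, hT⟩ := taylor_rpow q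
  refine ⟨|q| + C0 * 9, ?_⟩
  intro a b hab y hy
  have ha : |a| ≤ 1 := by rw [← sq_le_one_iff_abs_le_one]; nlinarith [sq_nonneg b]
  have hk3 : 0 ≤ indicator (Iic (1:ℝ)) (fun t => t ^ (2 * q)) |y| := by
    by_cases h : |y| ≤ 1
    · simp [indicator, h]; positivity
    · simp [indicator, h]
  unfold gfun bfun
  rw [abs_div, abs_of_nonneg (a := |y - a| ^ (1 + α)) (by positivity)]
  have hyb : y ^ 2 + b ^ 2 = 1 + (2 * a * (y - a) + (y - a) ^ 2) := by
    rw [← hab]; ring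
  by_cases hn : |y - a| ≤ 1/2
  · have hn' : ¬ (1/2 < |y - a|) := not_lt.2 hn
    simp only [indicator, mem_Iic, mem_Ioi, hn, hn', if_true, if_false, mul_zero, add_zero]
    have hfin : |(y ^ 2 + b ^ 2) ^ q - 1 - 2 * q * a * (y - a)| ≤ (|q| + C0 * 9) * |y - a| ^ 2 := by
      rw [hyb]
      set h := y - a with hh
      set t := 2 * a * h + h ^ 2 with ht
      have hah : |a * h| ≤ |h| := by
        rw [abs_mul]; nlinarith [abs_nonneg h]
      have hah' := abs_le.1 hah
      have hsq : h ^ 2 = |h| ^ 2 := (sq_abs h).symm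
      have h0 := abs_nonneg h
      have ht1 : -(3/4) ≤ t := by nlinarith
      have ht2 : t ≤ 5/4 := by nlinarith
      have htt : |t| ≤ 3 * |h| := by
        rw [abs_le]; constructor <;> nlinarith
      have e : (1 + t) ^ q - 1 - 2 * q * a * h = ((1 + t) ^ q - 1 - q * t) + q * h ^ 2 := by
        rw [ht]; ring
      rw [e]
      have ht3 : t ^ 2 ≤ 9 * |h| ^ 2 := by
        rw [← sq_abs t]; nlinarith [abs_nonneg t]
      calc _ ≤ |(1 + t) ^ q - 1 - q * t| + |q * h ^ 2| := abs_add_le _ _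
        _ ≤ C0 * t ^ 2 + |q| * |h| ^ 2 := by
          rw [abs_mul, abs_pow]; gcongr; exact hT t ht1 ht2
        _ ≤ C0 * (9 * |h| ^ 2) + |q| * |h| ^ 2 := by gcongr
        _ = _ := by ring
    have key : |(y ^ 2 + b ^ 2) ^ q - 1 - 2 * q * a * (y - a)| / |y - a| ^ (1 + α)
        ≤ (|q| + C0 * 9) * |y - a| ^ (1 - α) := by
      by_cases h0 : y - a = 0
      · have : (1 + α) ≠ 0 := by linarith
        rw [h0, abs_zero, Real.zero_rpow this, div_zero]
        positivity
      · have hp : 0 < |y - a| := abs_pos.2 h0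
        rw [div_le_iff₀ (by positivity), mul_assoc (|q| + C0 * 9), ← Real.rpow_add hp]
        have : 1 - α + (1 + α) = (2:ℕ) := by push_cast; ring
        rw [this, Real.rpow_natCast]
        exact hfin
    have : 0 ≤ (2:ℝ) ^ (1 + α) * indicator (Iic (1:ℝ)) (fun t => t ^ (2 * q)) |y| := by positivity
    simp only [indicator, mem_Iic] at this
    linarith
  · have hn' : 1/2 < |y - a| := not_le.1 hn
    simp only [indicator_of_notMem (show |y - a| ∉ Iic (1/2:ℝ) from hn),
      indicator_of_mem (show |y - a| ∈ Ioi (1/2:ℝ) from hn'), sub_zero, mul_zero, zero_add]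
    set k := indicator (Iic (1:ℝ)) (fun t => t ^ (2 * q)) |y| with hk
    set s := max 0 (2 * q) with hs
    have hs0 : 0 ≤ s := le_max_left _ _
    have hp : 0 < |y - a| := by linarith
    have h1 : 1 ≤ (4 * |y - a|) ^ s := Real.one_le_rpow (by linarith) hs0
    have hy2 : 0 < y ^ 2 := by positivity
    have hpos : 0 < y ^ 2 + b ^ 2 := by positivity
    have hf : (y ^ 2 + b ^ 2) ^ q ≤ (4 * |y - a|) ^ s + k := by
      by_cases hq : 0 ≤ q
      · have hsq : s = 2 * q := max_eq_right (by linarith)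
        have : (y ^ 2 + b ^ 2) ^ q ≤ (4 * |y - a|) ^ s := by
          rw [hsq, Real.rpow_mul (by positivity)]
          apply Real.rpow_le_rpow hpos.le _ hq
          rw [Real.rpow_two, hyb]
          set h := y - a
          have hah : a * h ≤ |h| := by
            refine (le_abs_self _).trans ?_
            rw [abs_mul]; nlinarith [abs_nonneg h]
          have hsq : h ^ 2 = |h| ^ 2 := (sq_abs h).symm
          nlinarith
        linarith
      · have hq' : q ≤ 0 := by linarith
        by_cases hy1 : |y| ≤ 1
        · have : k = |y| ^ (2 * q) := by rw [hk, indicator_of_mem (show |y| ∈ Iic (1:ℝ) from hy1)]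
          have h2 : (y ^ 2 + b ^ 2) ^ q ≤ k := by
            rw [this, Real.rpow_mul (abs_nonneg y), Real.rpow_two, sq_abs]
            exact Real.rpow_le_rpow_of_nonpos hy2 (by nlinarith [sq_nonneg b]) hq'
          linarith
        · have : 1 ≤ y ^ 2 + b ^ 2 := by
            have : 1 < |y| := not_le.1 hy1
            nlinarith [sq_abs y, sq_nonneg b]
          have := Real.rpow_le_one_of_one_le_of_nonpos this hq'
          linarith
    have hf0 : 0 ≤ (y ^ 2 + b ^ 2) ^ q := by positivity
    have habs : |(y ^ 2 + b ^ 2) ^ q - 1| ≤ 2 * (4 * |y - a|) ^ s + k := by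
      rw [abs_le]; constructor <;> linarith
    rw [div_le_iff₀ (by positivity), add_mul, mul_assoc, ← Real.rpow_add hp]
    rw [Real.mul_rpow (by norm_num) hp.le] at habs
    have h2 : 1 ≤ 2 ^ (1 + α) * |y - a| ^ (1 + α) := by
      rw [← Real.mul_rpow (by norm_num) hp.le]
      exact Real.one_le_rpow (by linarith) (by linarith)
    have e : s - (1 + α) + (1 + α) = s := by ring
    rw [e]
    nlinarith

lemma gfun_meas (α q a b : ℝ) : Measurable (gfun α q a b) := by
  unfold gfun
  have h : Measurable (fun y : ℝ => indicator (Iic (1/2:ℝ)) (fun _ => 2 * q * a * (y - a)) |y - a|) := by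
    simp only [indicator, mem_Iic]
    exact Measurable.ite (measurableSet_le (by fun_prop) (by fun_prop)) (by fun_prop) (by fun_prop)
  fun_prop

lemma ofun_meas (α q a : ℝ) : Measurable (ofun α q a) := by
  unfold ofun
  have h : Measurable (fun y : ℝ => indicator (Iic (1/2:ℝ)) (fun _ => 2 * q * a * y) |y|) := by
    simp only [indicator, mem_Iic]
    exact Measurable.ite (measurableSet_le (by fun_prop) (by fun_prop)) (by fun_prop) (by fun_prop)
  fun_prop

lemma S_meas (ε a : ℝ) : MeasurableSet {y : ℝ | ε < |y - a|} :=
  measurableSet_lt (by fun_prop) (by fun_prop)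

lemma odd_int (α q a ε : ℝ) (hα0 : 0 < α) (hε : 0 < ε) :
    IntegrableOn (fun y => ofun α q a (y - a)) {y : ℝ | ε < |y - a|} ∧
    ∫ y in {y : ℝ | ε < |y - a|}, ofun α q a (y - a) = 0 := by
  set G : ℝ → ℝ := indicator {h : ℝ | ε < |h|} (ofun α q a) with hG
  have hGm : MeasurableSet {h : ℝ | ε < |h|} := measurableSet_lt (by fun_prop) (by fun_prop)
  have e : indicator {y : ℝ | ε < |y - a|} (fun y => ofun α q a (y - a)) = fun y => G (y - a) := by
    ext y; simp [hG, indicator]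
  have hGi : Integrable G := by
    have hb : Integrable (indicator (Icc (-(1/2):ℝ) (1/2)) (fun _ => |2 * q * a| * (1/2) / ε ^ (1 + α))) :=
      (integrable_indicator_iff measurableSet_Icc).2 (by simp)
    refine hb.mono' ((ofun_meas α q a).indicator hGm).aestronglyMeasurable (Eventually.of_forall ?_)
    intro h
    by_cases h1 : |h| ≤ 1/2
    · rw [indicator_of_mem (show h ∈ Icc (-(1/2):ℝ) (1/2) from abs_le.1 h1)]
      by_cases h2 : ε < |h|
      · rw [hG, indicator_of_mem (show h ∈ {h : ℝ | ε < |h|} from h2)]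
        unfold ofun
        rw [indicator_of_mem (show |h| ∈ Iic (1/2:ℝ) from h1), norm_div, Real.norm_eq_abs,
          Real.norm_eq_abs, abs_mul, abs_of_nonneg (a := |h| ^ (1 + α)) (by positivity)]
        have : 0 ≤ 1 + α := by linarith
        gcongr
      · rw [hG, indicator_of_notMem (show h ∉ {h : ℝ | ε < |h|} from h2)]
        simp; positivity
    · have : G h = 0 := by
        have : ofun α q a h = 0 := by
          unfold ofun; rw [indicator_of_notMem (show |h| ∉ Iic (1/2:ℝ) from h1)]; simp
        simp [hG, indicator, this]
      rw [this, norm_zero]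
      exact indicator_nonneg (fun _ _ => by positivity) _
  constructor
  · rw [← integrable_indicator_iff (S_meas ε a), e]
    exact hGi.comp_sub_right a
  · rw [← integral_indicator (S_meas ε a), e, integral_sub_right_eq_self]
    have h1 := integral_neg_eq_self G volume
    have h2 : ∀ x, G (-x) = - G x := by
      intro x; simp only [hG, indicator, ofun, mem_ofPred_eq, abs_neg, mem_Iic]
      split_ifs <;> ring
    simp only [h2, integral_neg] at h1
    linarith

lemma unit_case (α q : ℝ) (hα0 : 0 < α) (hα2 : α < 2) (hq0 : -(1/2) < q) (hq1 : 2 * q < α) :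
    ∃ K : ℝ, ∀ a b : ℝ, a ^ 2 + b ^ 2 = 1 → ∃ Δ : ℝ,
      Tendsto (fun ε : ℝ => ∫ y in {y : ℝ | ε < |y - a|},
          ((y ^ 2 + b ^ 2) ^ q - 1) / |y - a| ^ (1 + α)) (nhdsWithin 0 (Ioi 0)) (nhds Δ) ∧
      |Δ| ≤ K := by
  obtain ⟨C, hC⟩ := gfun_bound α q hα0
  obtain ⟨K, hK⟩ := bfun_integral α q C hα0 hα2 hq0 hq1
  refine ⟨K, fun a b hab => ⟨∫ y, gfun α q a b y, ?_, ?_⟩⟩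
  · obtain ⟨hbi, -⟩ := hK a
    have h0 : ∀ᵐ x : ℝ, x ≠ 0 := by simp [ae_iff]
    have hgb : ∀ᵐ y : ℝ, ‖gfun α q a b y‖ ≤ bfun α q C a y := by
      filter_upwards [h0] with y hy using hC a b hab y hy
    have hgi : Integrable (gfun α q a b) := hbi.mono' (gfun_meas α q a b).aestronglyMeasurable hgb
    have hT : Tendsto (fun ε : ℝ => ∫ y, indicator {y : ℝ | ε < |y - a|} (gfun α q a b) y)
        (nhdsWithin 0 (Ioi 0)) (nhds (∫ y, gfun α q a b y)) := by
      refine tendsto_integral_filter_of_dominated_convergence (bfun α q C a) ?_ ?_ hbi ?_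
      · exact Eventually.of_forall fun ε =>
          ((gfun_meas α q a b).indicator (S_meas ε a)).aestronglyMeasurable
      · refine Eventually.of_forall fun ε => ?_
        filter_upwards [hgb] with y hy
        exact (norm_indicator_le_norm_self _ _).trans hy
      · refine Eventually.of_forall fun y => ?_
        by_cases hy : y - a = 0
        · have : gfun α q a b y = 0 := by
            have : (1 + α) ≠ 0 := by linarith
            simp [gfun, hy, Real.zero_rpow this]
          simp [indicator, this]
        · have hp : 0 < |y - a| := abs_pos.2 hy
          refine tendsto_const_nhds.congr' ?_
          have : ∀ᶠ ε : ℝ in nhdsWithin 0 (Ioi 0), ε < |y - a| :=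
            (eventually_lt_nhds hp).filter_mono nhdsWithin_le_nhds
          filter_upwards [this] with ε hε
          rw [indicator_of_mem (show y ∈ {y : ℝ | ε < |y - a|} from hε)]
    refine hT.congr' ?_
    filter_upwards [self_mem_nhdsWithin] with ε hε
    obtain ⟨o1, o2⟩ := odd_int α q a ε hα0 hε
    rw [integral_indicator (S_meas ε a)]
    have : ∀ y, ((y ^ 2 + b ^ 2) ^ q - 1) / |y - a| ^ (1 + α)
        = gfun α q a b y + ofun α q a (y - a) := by
      intro y; unfold gfun ofun; rw [← add_div]; congr 1; ring
    simp only [this]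
    rw [integral_add hgi.integrableOn o1, o2, add_zero]
  · obtain ⟨hbi, hbK⟩ := hK a
    rw [← hbK]
    have h0 : ∀ᵐ x : ℝ, x ≠ 0 := by simp [ae_iff]
    rw [← Real.norm_eq_abs]
    refine norm_integral_le_of_norm_le hbi ?_
    filter_upwards [h0] with y hy using hC a b hab y hy

lemma scaling (α q r a b ε : ℝ) (hr : 0 < r) (hab : a ^ 2 + b ^ 2 = 1) :
    ∫ y in {y : ℝ | ε < |y - r * a|},
      ((y ^ 2 + (r * b) ^ 2) ^ q - ((r * a) ^ 2 + (r * b) ^ 2) ^ q) / |y - r * a| ^ (1 + α)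
    = r ^ (2 * q - α) * ∫ y in {y : ℝ | ε / r < |y - a|},
      ((y ^ 2 + b ^ 2) ^ q - 1) / |y - a| ^ (1 + α) := by
  rw [← integral_indicator (S_meas _ _), ← integral_indicator (S_meas _ _), ← integral_const_mul]
  set F := indicator {y : ℝ | ε < |y - r * a|} (fun y : ℝ =>
    ((y ^ 2 + (r * b) ^ 2) ^ q - ((r * a) ^ 2 + (r * b) ^ 2) ^ q) / |y - r * a| ^ (1 + α)) with hF
  have h := Measure.integral_comp_mul_left F r
  have h2 : ∫ y, F y = r * ∫ x, F (r * x) := by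
    rw [h, abs_of_pos (by positivity), smul_eq_mul]; field_simp
  rw [h2, ← integral_const_mul]
  congr 1
  ext x
  have e1 : |r * x - r * a| = r * |x - a| := by rw [← mul_sub, abs_mul, abs_of_pos hr]
  have e2 : ε / r < |x - a| ↔ ε < r * |x - a| := by rw [div_lt_iff₀ hr, mul_comm]
  have e3 : ∀ u v : ℝ, ((r * u) ^ 2 + (r * v) ^ 2) ^ q = r ^ (2 * q) * (u ^ 2 + v ^ 2) ^ q := by
    intro u v
    rw [Real.rpow_mul hr.le, Real.rpow_two, ← Real.mul_rpow (by positivity) (by positivity)]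
    congr 1; ring
  simp only [hF, indicator, mem_ofPred_eq, e1, e2, e3, hab, Real.one_rpow]
  split_ifs
  · rw [Real.mul_rpow hr.le (abs_nonneg _)]
    have e4 : r ^ (2 * q) = r ^ (2 * q - α) * r ^ (1 + α) / r := by
      rw [← Real.rpow_add hr, eq_div_iff hr.ne']
      nth_rw 2 [← Real.rpow_one r]
      rw [← Real.rpow_add hr]; congr 1; ring
    rw [e4]
    have : r ^ (1 + α) ≠ 0 := by positivity
    field_simp
  · simp

/-- For `0 < α < 2` and `0 < p < α+1`, there is `c > 0` such that for every
`(z₁,z₂)` with `z₂ ≥ 0` and `0 < z₁² + z₂² < 1`, the principal value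
`Δ(z₁,z₂) = lim_{ε↓0} 𝒜(1,-α) ∫_{|y-z₁|>ε} ((y²+z₂²)^{(p-1)/2} - (z₁²+z₂²)^{(p-1)/2})/|y-z₁|^{1+α} dy`
exists, with `|Δ| ≤ c·|z₁|^{p-1-α}` whenever `z₁ ≠ 0` and `|Δ| ≤ c·z₂^{p-1-α}` whenever `z₂ > 0`. -/
theorem stmt13 (α p : ℝ) (hα0 : 0 < α) (hα2 : α < 2) (hp0 : 0 < p) (hp1 : p < α + 1) :
    ∃ c : ℝ, 0 < c ∧
      ∀ z₁ z₂ : ℝ, 0 ≤ z₂ → 0 < z₁ ^ 2 + z₂ ^ 2 → z₁ ^ 2 + z₂ ^ 2 < 1 →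
        ∃ Δ : ℝ,
          Tendsto
            (fun ε : ℝ => Aconst α *
              ∫ y in {y : ℝ | ε < |y - z₁|},
                ((y ^ 2 + z₂ ^ 2) ^ ((p - 1) / 2) - (z₁ ^ 2 + z₂ ^ 2) ^ ((p - 1) / 2)) /
                  |y - z₁| ^ (1 + α))
            (nhdsWithin 0 (Ioi 0)) (nhds Δ) ∧
          (z₁ ≠ 0 → |Δ| ≤ c * |z₁| ^ (p - 1 - α)) ∧
          (0 < z₂ → |Δ| ≤ c * z₂ ^ (p - 1 - α)) := by
  have hq0 : -(1/2) < (p - 1) / 2 := by linarith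
  have hq1 : 2 * ((p - 1) / 2) < α := by linarith
  obtain ⟨K, hK⟩ := unit_case α ((p - 1) / 2) hα0 hα2 hq0 hq1
  refine ⟨|Aconst α| * |K| + 1, by positivity, ?_⟩
  intro z₁ z₂ hz2 hz _
  set r := Real.sqrt (z₁ ^ 2 + z₂ ^ 2) with hr
  have hr0 : 0 < r := Real.sqrt_pos.2 hz
  have hrs : r ^ 2 = z₁ ^ 2 + z₂ ^ 2 := Real.sq_sqrt hz.le
  obtain ⟨a, ha⟩ : ∃ a, z₁ = r * a := ⟨z₁ / r, by field_simp⟩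
  obtain ⟨b, hb⟩ : ∃ b, z₂ = r * b := ⟨z₂ / r, by field_simp⟩
  have hab : a ^ 2 + b ^ 2 = 1 := by
    have h1 : r ^ 2 * (a ^ 2 + b ^ 2) = r ^ 2 * 1 := by rw [mul_one]; nth_rw 2 [hrs]; rw [ha, hb]; ring
    exact mul_left_cancel₀ (by positivity) h1
  obtain ⟨D, hD, hDK⟩ := hK a b hab
  have hbound : |Aconst α * (r ^ (p - 1 - α) * D)| ≤ (|Aconst α| * |K| + 1) * r ^ (p - 1 - α) := by
    rw [abs_mul, abs_mul, abs_of_pos (a := r ^ (p - 1 - α)) (by positivity)]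
    have h1 : |D| ≤ |K| := hDK.trans (le_abs_self K)
    have h2 : 0 < r ^ (p - 1 - α) := by positivity
    calc |Aconst α| * (r ^ (p - 1 - α) * |D|) ≤ |Aconst α| * (r ^ (p - 1 - α) * |K|) := by gcongr
      _ ≤ _ := by nlinarith
  refine ⟨Aconst α * (r ^ (p - 1 - α) * D), ?_, ?_, ?_⟩
  · have e : ∀ ε : ℝ, ∫ y in {y : ℝ | ε < |y - z₁|},
                ((y ^ 2 + z₂ ^ 2) ^ ((p - 1) / 2) - (z₁ ^ 2 + z₂ ^ 2) ^ ((p - 1) / 2)) /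
                  |y - z₁| ^ (1 + α) = r ^ (p - 1 - α) * ∫ y in {y : ℝ | ε / r < |y - a|},
                ((y ^ 2 + b ^ 2) ^ ((p - 1) / 2) - 1) / |y - a| ^ (1 + α) := by
      intro ε
      have := scaling α ((p - 1) / 2) r a b ε hr0 hab
      rw [← ha, ← hb] at this
      rw [this]; congr 2; ring
    simp only [e]
    refine Tendsto.const_mul _ (Tendsto.const_mul _ (hD.comp ?_))
    refine tendsto_nhdsWithin_iff.2 ⟨?_, ?_⟩
    · have : Tendsto (fun ε : ℝ => ε / r) (nhds 0) (nhds (0 / r)) := by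
        exact tendsto_id.div_const r
      rw [zero_div] at this
      exact this.mono_left nhdsWithin_le_nhds
    · filter_upwards [self_mem_nhdsWithin] with ε hε
      exact div_pos hε hr0
  · intro h
    refine hbound.trans ?_
    gcongr ?_ * ?_
    refine Real.rpow_le_rpow_of_nonpos (abs_pos.2 h) ?_ (by linarith)
    exact abs_le_of_sq_le_sq (by nlinarith [sq_nonneg z₂]) hr0.le
  · intro h
    refine hbound.trans ?_
    gcongr ?_ * ?_
    refine Real.rpow_le_rpow_of_nonpos h ?_ (by linarith)
    nlinarith [sq_nonneg z₁]
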